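/- arXiv:1307.0067 — 2 statements merged into one kernel-verified Lean document; each statement's English description precedes it below -/
import Mathlib

section
/- (Posterior matching achieves EJS at least capacity.) Consider a DMC with input alphabet 𝒳 = {0,1,…,K−1}, finite output alphabet 𝒴, transition pmfs P_x, and capacity C := max_π I(π). Let π* be a capacity-achieving input distribution, and assume (as holds for any capacity-achieving distribution) that D(P_x ‖ Σ_{x'} π*_{x'} P_{x'}) = C for every x with π*_x > 0. Let M ≥ 2 and let ρ = (ρ₁,…,ρ_M) be a probability vector with ρᵢ > 0 for all i. For i ∈ Ω = {1,…,M} and x ∈ 𝒳 define ρ̂_{i,x} := max{0, min(Σ_{i'≤i} ρ_{i'}, Σ_{x'≤x} π*_{x'}) − max(Σ_{i'<i} ρ_{i'}, Σ_{x'<x} π*_{x'})} and Λ_{i,x} := ρ̂_{i,x}/ρᵢ, and for each encoding function γ: Ω → 𝒳 set λ_γ := Π_{i=1}^M Λ_{i,γ(i)}. Then Σ_{γ: Ω→𝒳} λ_γ · EJS(ρ, γ) ≥ C (as extended reals). -/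
open Finset

/-- Kullback–Leibler divergence (base 2) between two pmfs on a finite set,
with the conventions `0·log₂(a/0) = 0` and `b·log₂(b/0) = +∞` for `b > 0`;
values in `[0,∞]` (formalized in the extended reals). -/
noncomputable def KL {Y : Type*} [Fintype Y] (P Q : Y → ℝ) : EReal :=
  ∑ y, if P y = 0 then (0 : EReal)
       else if Q y = 0 then (⊤ : EReal)
       else ((P y * Real.logb 2 (P y / Q y) : ℝ) : EReal)

/-- Extrinsic Jensen–Shannon divergence (for weight vectors with `ρ i < 1` for all `i`):
`EJS(ρ; P₁,…,P_M) = Σᵢ ρᵢ · D(Pᵢ ‖ Σ_{j≠i} (ρⱼ/(1−ρᵢ)) Pⱼ)`. -/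
noncomputable def EJS {Y : Type*} [Fintype Y] {M : ℕ} (ρ : Fin M → ℝ)
    (P : Fin M → Y → ℝ) : EReal :=
  ∑ i, ((ρ i : ℝ) : EReal) *
    KL (P i) (fun y => ∑ j ∈ univ.erase i, (ρ j / (1 - ρ i)) * P j y)

/-- The posterior-matching overlap mass
`ρ̂_{i,x} = [min(Σ_{i'≤i} ρ_{i'}, Σ_{x'≤x} π*_{x'}) − max(Σ_{i'<i} ρ_{i'}, Σ_{x'<x} π*_{x'})]⁺`. -/
noncomputable def rhoHat {K M : ℕ} (ρ : Fin M → ℝ) (pistar : Fin (K + 1) → ℝ)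
    (i : Fin M) (x : Fin (K + 1)) : ℝ :=
  max 0 (min (∑ i' ∈ Iic i, ρ i') (∑ x' ∈ Iic x, pistar x')
    - max (∑ i' ∈ Iio i, ρ i') (∑ x' ∈ Iio x, pistar x'))

/-- The overlap of `[s, t]` with `[a, b]` is the increment of the clamping map `u ↦ max a (min b u)`. -/
lemma overlap_eq_clamp_sub {a b s t : ℝ} (hab : a ≤ b) (hst : s ≤ t) :
    max 0 (min b t - max a s) = max a (min b t) - max a (min b s) := by
  rcases le_total b t with h1 | h1 <;> rcases le_total a s with h2 | h2 <;>
  rcases le_total b s with h3 | h3 <;> rcases le_total a t with h4 | h4 <;>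
  (simp only [h1, h2, h3, h4, hab, min_eq_left, min_eq_right, max_eq_left, max_eq_right]
   first
    | (rw [max_eq_left] <;> linarith)
    | (rw [max_eq_right] <;> linarith))

/-- Telescoping of a function along the partial sums of `p`. -/
lemma sum_partial_sums_sub {ι : Type*} [LinearOrder ι] (p : ι → ℝ) (F : ℝ → ℝ) (s : Finset ι) :
    ∑ x ∈ s, (F (∑ k ∈ s with k ≤ x, p k) - F (∑ k ∈ s with k < x, p k))
      = F (∑ k ∈ s, p k) - F 0 := by
  induction s using Finset.induction_on_max with
  | empty => simp
  | insert a s ha ih =>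
    have has : a ∉ s := fun h => lt_irrefl _ (ha a h)
    have h1 : {k ∈ insert a s | k ≤ a} = insert a s :=
      filter_true_of_mem fun k hk => by
        rcases mem_insert.1 hk with rfl | hk
        · exact le_rfl
        · exact (ha k hk).le
    have h2 : {k ∈ insert a s | k < a} = s := by
      rw [filter_insert, if_neg (lt_irrefl a), filter_true_of_mem ha]
    have h3 : ∀ x ∈ s, F (∑ k ∈ insert a s with k ≤ x, p k) - F (∑ k ∈ insert a s with k < x, p k)
        = F (∑ k ∈ s with k ≤ x, p k) - F (∑ k ∈ s with k < x, p k) := fun x hx => by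
      rw [filter_insert, if_neg (ha x hx).not_ge, filter_insert, if_neg (ha x hx).not_gt]
    rw [sum_insert has, h1, h2, sum_congr rfl h3, ih]
    ring

/-- The overlaps of `[a, b] ⊆ [0, 1]` with the cells of a partition of `[0, 1]` add up to `b - a`. -/
lemma sum_overlap {n : ℕ} (p : Fin n → ℝ) (hp : ∀ x, 0 ≤ p x) (hp1 : ∑ x, p x = 1) {a b : ℝ}
    (ha : 0 ≤ a) (hab : a ≤ b) (hb : b ≤ 1) :
    ∑ x, max 0 (min b (∑ k ∈ Iic x, p k) - max a (∑ k ∈ Iio x, p k)) = b - a := by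
  have key := sum_partial_sums_sub p (fun u => max a (min b u)) univ
  rw [hp1, min_eq_left hb, max_eq_right hab, min_eq_right (ha.trans hab), max_eq_left ha] at key
  rw [← key]
  refine sum_congr rfl fun x _ => ?_
  have e1 : Iic x = ({k | k ≤ x} : Finset (Fin n)) := by ext; simp
  have e2 : Iio x = ({k | k < x} : Finset (Fin n)) := by ext; simp
  rw [overlap_eq_clamp_sub hab
    (sum_le_sum_of_subset_of_nonneg (Iio_subset_Iic_self) fun k _ _ => hp k), e1, e2]

lemma sum_Iic_eq_add_sum_Iio {n : ℕ} (p : Fin n → ℝ) (i : Fin n) :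
    ∑ k ∈ Iic i, p k = p i + ∑ k ∈ Iio i, p k := by
  rw [← Iio_insert i, sum_insert (by simp)]

lemma rhoHat_nonneg {K M : ℕ} (ρ : Fin M → ℝ) (p : Fin (K + 1) → ℝ) (i : Fin M)
    (x : Fin (K + 1)) : 0 ≤ rhoHat ρ p i x := le_max_left _ _

lemma sum_rhoHat_right {K M : ℕ} {ρ : Fin M → ℝ} {p : Fin (K + 1) → ℝ}
    (hρ : ∀ i, 0 ≤ ρ i) (hρ1 : ∑ i, ρ i = 1) (hp : ∀ x, 0 ≤ p x) (hp1 : ∑ x, p x = 1)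
    (i : Fin M) : ∑ x, rhoHat ρ p i x = ρ i := by
  have h := sum_Iic_eq_add_sum_Iio ρ i
  refine (sum_overlap p hp hp1 (sum_nonneg fun k _ => hρ k) (by linarith [hρ i])
    (hρ1 ▸ sum_le_univ_sum_of_nonneg hρ)).trans (by linarith)

lemma sum_rhoHat_left {K M : ℕ} {ρ : Fin M → ℝ} {p : Fin (K + 1) → ℝ}
    (hρ : ∀ i, 0 ≤ ρ i) (hρ1 : ∑ i, ρ i = 1) (hp : ∀ x, 0 ≤ p x) (hp1 : ∑ x, p x = 1)
    (x : Fin (K + 1)) : ∑ i, rhoHat ρ p i x = p x := by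
  have h := sum_Iic_eq_add_sum_Iio p x
  simp only [rhoHat, min_comm (∑ _ ∈ _, ρ _), max_comm (∑ _ ∈ _, ρ _)]
  refine (sum_overlap ρ hρ hρ1 (sum_nonneg fun k _ => hp k) (by linarith [hp x])
    (hp1 ▸ sum_le_univ_sum_of_nonneg hp)).trans (by linarith)

section ProductWeights

variable {ι X : Type*} [Fintype ι] [DecidableEq ι] [Fintype X] {W : ι → X → ℝ}

lemma sum_prod_weights (hW : ∀ i, ∑ x, W i x = 1) : ∑ γ : ι → X, ∏ k, W k (γ k) = 1 := by
  classical
  rw [← Fintype.prod_sum]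
  simp [hW]

lemma sum_prod_weights_mul (hW : ∀ i, ∑ x, W i x = 1) (i : ι) (f : X → ℝ) :
    ∑ γ : ι → X, (∏ k, W k (γ k)) * f (γ i) = ∑ x, W i x * f x := by
  classical
  have h := Fintype.prod_sum fun k x => W k x * if k = i then f x else 1
  simp only [prod_mul_distrib, prod_ite_eq', mem_univ, if_true] at h
  rw [← h, prod_eq_single i (fun k _ hk => by simp [hk, hW]) (by simp)]
  simp

lemma sum_prod_weights_mul_mul (hW : ∀ i, ∑ x, W i x = 1) {i j : ι} (hij : i ≠ j) (f g : X → ℝ) :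
    ∑ γ : ι → X, (∏ k, W k (γ k)) * (f (γ i) * g (γ j))
      = (∑ x, W i x * f x) * ∑ x, W j x * g x := by
  classical
  have h := Fintype.prod_sum fun k x =>
    W k x * ((if k = i then f x else 1) * if k = j then g x else 1)
  simp only [prod_mul_distrib, prod_ite_eq', mem_univ, if_true] at h
  rw [← h, Fintype.prod_eq_mul i j hij (fun k hk => by simp [hk.1, hk.2, hW])]
  simp [hij, hij.symm]

end ProductWeights

lemma coe_sum_ereal {ι : Type*} (s : Finset ι) (f : ι → ℝ) :
    ((∑ i ∈ s, f i : ℝ) : EReal) = ∑ i ∈ s, (f i : EReal) := by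
  classical
  induction s using Finset.induction_on with
  | empty => simp
  | insert a s ha ih => rw [sum_insert ha, sum_insert ha, EReal.coe_add, ih]

/-- Tangent-line lower bound on the divergence, with base point `S` in the second argument. -/
lemma le_KL_of_tangent {Y : Type*} [Fintype Y] {P R S : Y → ℝ} (hP : ∀ y, 0 ≤ P y)
    (hR : ∀ y, 0 ≤ R y) (hS : ∀ y, 0 < P y → 0 < S y) {C : ℝ} (hC : KL P S = C) :
    ((C + (∑ y, P y * (1 - R y / S y)) / Real.log 2 : ℝ) : EReal) ≤ KL P R := by
  have hCr : C = ∑ y, P y * Real.logb 2 (P y / S y) := by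
    rw [← EReal.coe_eq_coe_iff, ← hC, KL, coe_sum_ereal]
    refine sum_congr rfl fun y _ => ?_
    split_ifs with h1 h2
    · simp [h1]
    · exact absurd h2 (hS y ((hP y).lt_of_ne' h1)).ne'
    · rfl
  rw [hCr, sum_div, ← sum_add_distrib, KL, coe_sum_ereal]
  refine sum_le_sum fun y _ => ?_
  split_ifs with h1 h2
  · simp [h1]
  · exact le_top
  · have hPy := (hP y).lt_of_ne' h1
    have hRy := (hR y).lt_of_ne' h2
    have hSy := hS y hPy
    rw [EReal.coe_le_coe_iff]
    have h2 : 0 < Real.log 2 := Real.log_pos one_lt_two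
    have hlog := Real.log_le_sub_one_of_pos (div_pos hRy hSy)
    rw [Real.log_div hRy.ne' hSy.ne'] at hlog
    rw [Real.logb, Real.logb, Real.log_div hPy.ne' hSy.ne', Real.log_div hPy.ne' hRy.ne',
      mul_div_assoc', mul_div_assoc', ← add_div]
    gcongr
    nlinarith

lemma mul_sub_le_mul_one_sub_div {r p q : ℝ} (hr0 : 0 < r) (hr1 : r < 1) (hp : 0 ≤ p)
    (hq : 0 ≤ q) : r * (p - q) ≤ p * (1 - q / (r * p + (1 - r) * q)) := by
  have hr := sub_pos.2 hr1
  have hrp := mul_nonneg hr0.le hp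
  have hrq := mul_nonneg hr.le hq
  rcases (add_nonneg hrp hrq).eq_or_lt with h | h
  · have hp0 : p = 0 := by
      have : r * p = 0 := by linarith
      simpa [hr0.ne'] using this
    subst hp0
    simpa using mul_nonneg hr0.le hq
  · rw [← sub_nonneg]
    have : p * (1 - q / (r * p + (1 - r) * q)) - r * (p - q)
        = r * (1 - r) * (p - q) ^ 2 / (r * p + (1 - r) * q) := by
      rw [eq_div_iff h.ne', sub_mul, mul_assoc, sub_mul, div_mul_cancel₀ _ h.ne']
      ring
    rw [this]
    positivity

/-- Under independent inputs, the tangent-line correction terms have nonnegative mean. -/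
lemma sum_prod_weights_mul_correction_nonneg {K M : ℕ} {Y : Type*} [Fintype Y]
    {P : Fin (K + 1) → Y → ℝ} (hP0 : ∀ x y, 0 ≤ P x y) (hP1 : ∀ x, ∑ y, P x y = 1)
    {W : Fin M → Fin (K + 1) → ℝ} (hW0 : ∀ i x, 0 ≤ W i x) (hW1 : ∀ i, ∑ x, W i x = 1)
    {ρ : Fin M → ℝ} (hρ0 : ∀ i, 0 < ρ i) (hρ1 : ∑ i, ρ i = 1) {i : Fin M} (hi : ρ i < 1)
    {S : Y → ℝ} (hS : ∀ y, S y = ∑ j, ρ j * ∑ x, W j x * P x y) :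
    0 ≤ ∑ γ : Fin M → Fin (K + 1), (∏ k, W k (γ k)) *
      ∑ y, P (γ i) y * (1 - (∑ j ∈ univ.erase i, (ρ j / (1 - ρ i)) * P (γ j) y) / S y) := by
  set p : Fin M → Y → ℝ := fun j y => ∑ x, W j x * P x y with hp
  set q : Y → ℝ := fun y => ∑ j ∈ univ.erase i, (ρ j / (1 - ρ i)) * p j y with hq
  have h1 : 0 < 1 - ρ i := sub_pos.2 hi
  have hp0 : ∀ j y, 0 ≤ p j y := fun j y => sum_nonneg fun x _ => mul_nonneg (hW0 j x) (hP0 x y)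
  have hp1 : ∀ j, ∑ y, p j y = 1 := fun j => by
    simp only [hp]
    rw [sum_comm]
    simp [← mul_sum, hP1, hW1]
  have hq0 : ∀ y, 0 ≤ q y := fun y =>
    sum_nonneg fun j _ => mul_nonneg (div_nonneg (hρ0 j).le h1.le) (hp0 j y)
  have hρi : ∑ j ∈ univ.erase i, ρ j = 1 - ρ i := by
    rw [← hρ1, ← add_sum_erase univ ρ (mem_univ i)]; ring
  have hq1 : ∑ y, q y = 1 := by
    simp only [hq]
    rw [sum_comm]
    simp only [← mul_sum, hp1, mul_one, ← sum_div, hρi]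
    exact div_self h1.ne'
  have hSq : ∀ y, S y = ρ i * p i y + (1 - ρ i) * q y := fun y => by
    rw [hS, ← add_sum_erase univ _ (mem_univ i)]
    simp only [hq]
    rw [mul_sum (s := univ.erase i)]
    refine congrArg _ ?_
    refine sum_congr rfl fun j _ => ?_
    rw [← mul_assoc, mul_div_cancel₀ _ h1.ne']
  have hmean : ∀ y, ∑ γ : Fin M → Fin (K + 1), (∏ k, W k (γ k)) *
      (P (γ i) y * (1 - (∑ j ∈ univ.erase i, (ρ j / (1 - ρ i)) * P (γ j) y) / S y))
      = p i y * (1 - q y / S y) := fun y => by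
    have hcross : ∑ γ : Fin M → Fin (K + 1), (∏ k, W k (γ k)) *
        (P (γ i) y * ∑ j ∈ univ.erase i, (ρ j / (1 - ρ i)) * P (γ j) y) = p i y * q y := by
      simp only [hq, mul_sum]
      rw [sum_comm]
      refine sum_congr rfl fun j hj => ?_
      have := sum_prod_weights_mul_mul hW1 (ne_of_mem_erase hj).symm (P · y) (P · y)
      rw [mul_left_comm, ← this, mul_sum]
      exact sum_congr rfl fun γ _ => by ring
    have hpi : p i y = ∑ x, W i x * P x y := rfl
    rw [mul_sub, mul_one, mul_div_assoc', ← hcross, hpi, ← sum_prod_weights_mul hW1 i (P · y),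
      sum_div, ← sum_sub_distrib]
    exact sum_congr rfl fun γ _ => by ring
  simp_rw [mul_sum (s := (univ : Finset Y))]
  rw [sum_comm]
  simp only [hmean]
  calc (0 : ℝ) = ∑ y, ρ i * (p i y - q y) := by rw [← mul_sum, sum_sub_distrib, hp1, hq1]; simp
    _ ≤ _ := sum_le_sum fun y _ => by
      rw [hSq]
      exact mul_sub_le_mul_one_sub_div (hρ0 i) hi (hp0 i y) (hq0 y)

/-- Proposition 1: the variable-length posterior matching scheme obtains EJS divergence at
least the capacity `C`: `Σ_γ λ_γ · EJS(ρ, γ) ≥ C`, where `λ_γ = Π_i ρ̂_{i,γ(i)}/ρᵢ`. -/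
theorem posterior_matching_ejs_ge_capacity
    (K L M : ℕ) (hM : 2 ≤ M)
    (Pch : Fin (K + 1) → Fin (L + 1) → ℝ)
    (hch0 : ∀ x y, 0 ≤ Pch x y) (hch1 : ∀ x, ∑ y, Pch x y = 1)
    (C : ℝ)
    (pistar : Fin (K + 1) → ℝ)
    (hpi0 : ∀ x, 0 ≤ pistar x) (hpi1 : ∑ x, pistar x = 1)
    -- `C` is the capacity: no input distribution has larger mutual information
    (hCmax : ∀ π : Fin (K + 1) → ℝ, (∀ x, 0 ≤ π x) → ∑ x, π x = 1 →
      ∑ x, ((π x : ℝ) : EReal) * KL (Pch x) (fun y => ∑ x', π x' * Pch x' y)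
        ≤ (C : EReal))
    -- `π*` is capacity-achieving: `D(P_x ‖ Σ_{x'} π*_{x'} P_{x'}) = C` whenever `π*_x > 0`
    (hFact : ∀ x, 0 < pistar x →
      KL (Pch x) (fun y => ∑ x', pistar x' * Pch x' y) = (C : EReal))
    (ρ : Fin M → ℝ) (hρpos : ∀ i, 0 < ρ i) (hρ1 : ∑ i, ρ i = 1) :
    (C : EReal) ≤
      ∑ γ : Fin M → Fin (K + 1),
        ((∏ i, rhoHat ρ pistar i (γ i) / ρ i : ℝ) : EReal) *
          EJS ρ (fun i => Pch (γ i)) := by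
  set W : Fin M → Fin (K + 1) → ℝ := fun i x => rhoHat ρ pistar i x / ρ i with hW
  set S : Fin (L + 1) → ℝ := fun y => ∑ x, pistar x * Pch x y with hS
  have hW0 : ∀ i x, 0 ≤ W i x := fun i x => div_nonneg (rhoHat_nonneg _ _ _ _) (hρpos i).le
  have hW1 : ∀ i, ∑ x, W i x = 1 := fun i => by
    rw [hW, ← sum_div, sum_rhoHat_right (fun i => (hρpos i).le) hρ1 hpi0 hpi1,
      div_self (hρpos i).ne']
  have hWρ : ∀ i x, ρ i * W i x = rhoHat ρ pistar i x := fun i x =>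
    mul_div_cancel₀ _ (hρpos i).ne'
  have hWpi : ∀ x, ∑ i, ρ i * W i x = pistar x := fun x => by
    simp only [hWρ]
    exact sum_rhoHat_left (fun i => (hρpos i).le) hρ1 hpi0 hpi1 x
  have hρlt : ∀ i, ρ i < 1 := fun i => by
    have : Nontrivial (Fin M) := Fin.nontrivial_iff_two_le.2 hM
    obtain ⟨j, hj⟩ := exists_ne i
    rw [← hρ1]
    exact single_lt_sum hj (mem_univ i) (mem_univ j) (hρpos j) fun k _ _ => (hρpos k).le
  have hSmix : ∀ y, S y = ∑ j, ρ j * ∑ x, W j x * Pch x y := fun y => by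
    simp only [hS, ← hWpi, sum_mul, mul_sum]
    rw [sum_comm]
    exact sum_congr rfl fun j _ => sum_congr rfl fun x _ => by ring
  have hSpos : ∀ x y, 0 < pistar x → 0 < Pch x y → 0 < S y := fun x y hx hy =>
    (mul_pos hx hy).trans_le
      (single_le_sum (f := fun x => pistar x * Pch x y)
        (fun x _ => mul_nonneg (hpi0 x) (hch0 x y)) (mem_univ x))
  let corr : (Fin M → Fin (K + 1)) → Fin M → ℝ := fun γ i =>
    ∑ y, Pch (γ i) y * (1 - (∑ j ∈ univ.erase i, (ρ j / (1 - ρ i)) * Pch (γ j) y) / S y)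
  have hterm : ∀ γ : Fin M → Fin (K + 1),
      (((∏ i, W i (γ i)) * ∑ i, ρ i * (C + corr γ i / Real.log 2) : ℝ) : EReal)
        ≤ ((∏ i, W i (γ i) : ℝ) : EReal) * EJS ρ (fun i => Pch (γ i)) := fun γ => by
    have hnn : 0 ≤ ∏ i, W i (γ i) := prod_nonneg fun i _ => hW0 i _
    rcases hnn.eq_or_lt with h0 | hpos
    · simp [← h0]
    · rw [EReal.coe_mul]
      refine mul_le_mul_of_nonneg_left ?_ (EReal.coe_nonneg.2 hnn)
      rw [EJS, coe_sum_ereal]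
      refine sum_le_sum fun i _ => ?_
      rw [EReal.coe_mul]
      refine mul_le_mul_of_nonneg_left ?_ (EReal.coe_nonneg.2 (hρpos i).le)
      have hWi : 0 < W i (γ i) := (hW0 i _).lt_of_ne' fun h =>
        hpos.ne' (prod_eq_zero (mem_univ i) h)
      have hpi : 0 < pistar (γ i) := by
        rw [← hWpi]
        exact (mul_pos (hρpos i) hWi).trans_le
          (single_le_sum (f := fun j => ρ j * W j (γ i))
            (fun j _ => mul_nonneg (hρpos j).le (hW0 j _)) (mem_univ i))
      exact le_KL_of_tangent (hch0 _)
        (fun y => sum_nonneg fun j _ =>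
          mul_nonneg (div_nonneg (hρpos j).le (sub_pos.2 (hρlt i)).le) (hch0 _ y))
        (fun y => hSpos _ y hpi) (hFact _ hpi)
  refine le_trans ?_ (sum_le_sum fun γ _ => hterm γ)
  rw [← coe_sum_ereal, EReal.coe_le_coe_iff]
  have hcorr : ∀ i, 0 ≤ ∑ γ : Fin M → Fin (K + 1), (∏ k, W k (γ k)) * corr γ i := fun i =>
    sum_prod_weights_mul_correction_nonneg hch0 hch1 hW0 hW1 hρpos hρ1 (hρlt i) hSmix
  have hlog : 0 < Real.log 2 := Real.log_pos one_lt_two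
  calc C ≤ C + (∑ i, ρ i * ∑ γ : Fin M → Fin (K + 1), (∏ k, W k (γ k)) * corr γ i)
        / Real.log 2 :=
        le_add_of_nonneg_right
          (div_nonneg (sum_nonneg fun i _ => mul_nonneg (hρpos i).le (hcorr i)) hlog.le)
    _ = ∑ γ : Fin M → Fin (K + 1), (∏ i, W i (γ i)) *
          (C + (∑ i, ρ i * corr γ i) / Real.log 2) := by
        simp only [mul_add, sum_add_distrib, ← sum_mul, sum_prod_weights hW1, one_mul,
          mul_div_assoc', ← sum_div]
        simp only [mul_sum]
        rw [sum_comm]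
        simp only [mul_left_comm]
    _ = _ := by
        refine sum_congr rfl fun γ _ => ?_
        simp only [mul_add, sum_add_distrib, ← sum_mul, hρ1, one_mul, mul_div_assoc', ← sum_div]
end

section
/- (Generalized Horstein–Burnashev–Zigangirov scheme.) Consider a binary-input channel with 𝒳 = {0,1}, finite output alphabet 𝒴, and pmfs P₀, P₁ on 𝒴 such that there is a permutation f of 𝒴 with f ∘ f = id and P₀(y) = P₁(f(y)) for all y ∈ 𝒴. Let M ≥ 2, let ρ be a probability vector on Ω = {1,…,M} with ρᵢ < 1 for all i, and let k* ∈ {1,…,M} be a minimizer of |Σ_{i=1}^k ρᵢ − 1/2| over k ∈ {1,…,M}. Define the encoding function γ by γ(i) = 0 for i ≤ k* and γ(i) = 1 for i > k*. Then EJS(ρ, γ) ≥ D(P₀ ‖ ½P₀ + ½P₁) (which equals the capacity of such a symmetric binary-input channel). -/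
open Finset

lemma EReal.coe_sum_finset {ι : Type*} (s : Finset ι) (g : ι → ℝ) :
    ((∑ i ∈ s, g i : ℝ) : EReal) = ∑ i ∈ s, (g i : EReal) := by
  classical
  induction s using Finset.induction_on with
  | empty => simp
  | insert a s ha ih => rw [sum_insert ha, sum_insert ha, EReal.coe_add, ih]

lemma KL_eq_coe {Y : Type*} [Fintype Y] {P R : Y → ℝ} (hR : ∀ y, P y ≠ 0 → R y ≠ 0) :
    KL P R = ((∑ y, P y * Real.logb 2 (P y / R y) : ℝ) : EReal) := by
  rw [EReal.coe_sum_finset, KL]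
  refine sum_congr rfl fun y _ => ?_
  by_cases h : P y = 0
  · simp [h]
  · simp [h, hR y h]

/-- First-order lower bound for the divergence in its second argument, from
`log x ≤ x - 1`. -/
lemma coe_tangent_le_KL {Y : Type*} [Fintype Y] {P Q R : Y → ℝ}
    (hP : ∀ y, 0 ≤ P y) (hQ : ∀ y, 0 ≤ Q y) (hR : ∀ y, P y ≠ 0 → 0 < R y) :
    ((∑ y, P y * (Real.logb 2 (P y / R y) - (Q y / R y - 1) / Real.log 2) : ℝ) : EReal)
      ≤ KL P Q := by
  rw [EReal.coe_sum_finset, KL]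
  refine sum_le_sum fun y _ => ?_
  by_cases h : P y = 0
  · simp [h]
  by_cases hq : Q y = 0
  · simp [h, hq]
  have hRy := hR y h
  have hQy : 0 < Q y := lt_of_le_of_ne (hQ y) (Ne.symm hq)
  have hlog := Real.log_le_sub_one_of_pos (div_pos hQy hRy)
  rw [Real.log_div hq hRy.ne'] at hlog
  simp only [h, hq, if_false, EReal.coe_le_coe_iff]
  refine mul_le_mul_of_nonneg_left ?_ (hP y)
  have h2 : 0 < Real.log 2 := Real.log_pos one_lt_two
  rw [Real.logb, Real.logb, ← sub_div, Real.log_div h hRy.ne', Real.log_div h hq]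
  exact div_le_div_of_nonneg_right (by linarith) h2.le

/-- The slope at the midpoint of the tangent to `a ↦ KL P ((1 - a) P + a Q)`. -/
noncomputable def midpointSlope {Y : Type*} [Fintype Y] (P Q : Y → ℝ) : ℝ :=
  (∑ y, P y * ((P y - Q y) / (1 / 2 * P y + 1 / 2 * Q y))) / Real.log 2

lemma midpointSlope_nonneg {Y : Type*} [Fintype Y] {P Q : Y → ℝ}
    (hP : ∀ y, 0 ≤ P y) (hQ : ∀ y, 0 ≤ Q y) (h : ∑ y, P y = ∑ y, Q y) :
    0 ≤ midpointSlope P Q := by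
  refine div_nonneg ?_ (Real.log_nonneg one_le_two)
  have key : ∀ y, P y - Q y ≤ P y * ((P y - Q y) / (1 / 2 * P y + 1 / 2 * Q y)) := by
    intro y
    have hp := hP y
    have hq := hQ y
    rcases (by positivity : 0 ≤ 1 / 2 * P y + 1 / 2 * Q y).eq_or_lt with h0 | h0
    · have hp0 : P y = 0 := by linarith
      have hq0 : Q y = 0 := by linarith
      rw [hp0, hq0]
      simp
    · rw [← mul_div_assoc, le_div_iff₀ h0]
      nlinarith [sq_nonneg (P y - Q y)]
  calc (0 : ℝ) = ∑ y, (P y - Q y) := by rw [sum_sub_distrib, h, sub_self]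
    _ ≤ _ := sum_le_sum fun y _ => key y

lemma coe_midpoint_tangent_le_KL {Y : Type*} [Fintype Y] {P Q : Y → ℝ}
    (hP : ∀ y, 0 ≤ P y) (hQ : ∀ y, 0 ≤ Q y) {a : ℝ} (ha0 : 0 ≤ a) (ha1 : a ≤ 1) :
    ((∑ y, P y * Real.logb 2 (P y / (1 / 2 * P y + 1 / 2 * Q y))
        + midpointSlope P Q * (a - 1 / 2) : ℝ) : EReal)
      ≤ KL P (fun y => (1 - a) * P y + a * Q y) := by
  have hR : ∀ y, P y ≠ 0 → 0 < 1 / 2 * P y + 1 / 2 * Q y := fun y h => by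
    have := lt_of_le_of_ne (hP y) (Ne.symm h)
    have := hQ y
    positivity
  refine le_trans (le_of_eq ?_) (coe_tangent_le_KL hP (fun y => ?_) hR)
  · congr 1
    rw [midpointSlope, div_mul_eq_mul_div, sum_mul, sum_div, ← sum_add_distrib]
    refine sum_congr rfl fun y _ => ?_
    by_cases h : P y = 0
    · simp [h]
    have hmid : ((1 - a) * P y + a * Q y) / (1 / 2 * P y + 1 / 2 * Q y) - 1
        = -(a - 1 / 2) * ((P y - Q y) / (1 / 2 * P y + 1 / 2 * Q y)) := by
      rw [div_sub_one (hR y h).ne', ← mul_div_assoc]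
      congr 1
      ring
    rw [hmid]
    ring
  · exact add_nonneg (mul_nonneg (sub_nonneg.2 ha1) (hP y)) (mul_nonneg ha0 (hQ y))

/-- At a threshold whose partial sum is closest to `1 / 2`, the heavier side has an element
whose weight is at least the imbalance. -/
lemma exists_imbalance_le_weight {M : ℕ} {ρ : Fin M → ℝ} (hρ0 : ∀ i, 0 ≤ ρ i)
    (hρ1 : ∑ i, ρ i = 1) {k : ℕ} (hk1 : 1 ≤ k) (hkM : k ≤ M) {s : ℝ}
    (hs : s = ∑ i ∈ univ.filter (fun i : Fin M => (i : ℕ) < k), ρ i)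
    (hmin : ∀ l : ℕ, 1 ≤ l → l ≤ M →
      |s - 1 / 2| ≤ |(∑ i ∈ univ.filter (fun i : Fin M => (i : ℕ) < l), ρ i) - 1 / 2|) :
    ∃ i : Fin M, 0 ≤ 1 - 2 * (if (i : ℕ) < k then 1 - s else s) ∧
      1 - 2 * (if (i : ℕ) < k then 1 - s else s) ≤ ρ i := by
  set S : ℕ → ℝ := fun l => ∑ i ∈ univ.filter (fun i : Fin M => (i : ℕ) < l), ρ i with hS
  have hsucc : ∀ l (hl : l < M), S (l + 1) = S l + ρ ⟨l, hl⟩ := by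
    intro l hl
    have : univ.filter (fun i : Fin M => (i : ℕ) < l + 1)
        = insert ⟨l, hl⟩ (univ.filter (fun i : Fin M => (i : ℕ) < l)) := by
      ext i
      simp only [mem_filter, mem_univ, true_and, mem_insert, Fin.ext_iff]
      omega
    simp only [hS]
    rw [this, sum_insert (by simp), add_comm]
  have hSM : S M = 1 := by simp [hS, hρ1]
  have hS0 : S 0 = 0 := by simp [hS]
  have hgap : ∀ l, 1 ≤ l → l ≤ M → |s - 1 / 2| ≤ |S l - 1 / 2| := hmin
  by_contra! hcon
  rcases le_total (1 / 2) s with hhalf | hhalf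
  · have hlt : ∀ l (hl : l < M), l < k → ρ ⟨l, hl⟩ < 2 * s - 1 := by
      intro l hl hlk
      have := hcon ⟨l, hl⟩
      simp only [hlk, if_true] at this
      linarith [this (by linarith)]
    have hdown : ∀ l, l ≤ k → 1 ≤ l → s ≤ S l := by
      intro l hl
      induction hl using Nat.decreasingInduction with
      | self => exact fun _ => hs.le
      | of_succ l hlk ih =>
        intro h1
        have h2 := ih (by omega)
        rw [hsucc l (by omega)] at h2
        have h3 := hlt l (by omega) hlk
        have h4 := hgap l h1 (by omega)
        rw [abs_of_nonneg (by linarith)] at h4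
        rcases le_abs.1 h4 with h | h <;> linarith
    have h1 := hdown 1 hk1 le_rfl
    rw [hsucc 0 (by omega), hS0] at h1
    have h2 := hlt 0 (by omega) (by omega)
    have h3 : s ≤ 1 := by
      rw [hs, ← hρ1]
      exact sum_le_sum_of_subset_of_nonneg (filter_subset _ _) fun i _ _ => hρ0 i
    linarith
  · have hlt : ∀ l (hl : l < M), k ≤ l → ρ ⟨l, hl⟩ < 1 - 2 * s := by
      intro l hl hlk
      have := hcon ⟨l, hl⟩
      simp only [hlk.not_gt, if_false] at this
      exact this (by linarith)
    have hup : ∀ l, k ≤ l → l ≤ M → S l ≤ s := by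
      intro l hl
      induction l, hl using Nat.le_induction with
      | base => exact fun _ => hs.ge
      | succ l hkl ih =>
        intro h1
        have h2 := ih (by omega)
        have h3 := hlt l (by omega) hkl
        have h4 := hgap (l + 1) (by omega) h1
        have h5 := hsucc l (by omega)
        rw [abs_of_nonpos (by linarith)] at h4
        rcases le_abs.1 h4 with h | h <;> linarith
    have := hup M hkM le_rfl
    linarith

/-- If the weights `w i` are `1 - s` or `s` and some `ρ i` is at least the imbalance `1 - 2 w i`,
then the average of `w i / (1 - ρ i)` is at least `1 / 2`. -/
lemma half_le_sum_mul_div_one_sub {ι : Type*} [Fintype ι] {ρ w : ι → ℝ} {s : ℝ}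
    (hρlt : ∀ i, ρ i < 1) (hw : ∀ i, 0 ≤ w i)
    (hsum : ∑ i, ρ i * w i = 2 * s * (1 - s)) {i₀ : ι} (hw₀ : w i₀ = 1 - s ∨ w i₀ = s)
    (h0 : 0 ≤ 1 - 2 * w i₀) (h1 : 1 - 2 * w i₀ ≤ ρ i₀) :
    1 / 2 ≤ ∑ i, ρ i * (w i / (1 - ρ i)) := by
  have hsplit : ∀ i, ρ i * (w i / (1 - ρ i)) = ρ i * w i + w i * ρ i ^ 2 / (1 - ρ i) := by
    intro i
    have : 1 - ρ i ≠ 0 := by linarith [hρlt i]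
    field_simp
    ring
  have hsingle : w i₀ * ρ i₀ ^ 2 / (1 - ρ i₀) ≤ ∑ i, w i * ρ i ^ 2 / (1 - ρ i) :=
    single_le_sum (f := fun i => w i * ρ i ^ 2 / (1 - ρ i))
      (fun i _ => div_nonneg (mul_nonneg (hw i) (sq_nonneg _)) (by linarith [hρlt i]))
      (mem_univ i₀)
  have hgain : (1 - 2 * w i₀) ^ 2 / 2 ≤ w i₀ * ρ i₀ ^ 2 / (1 - ρ i₀) := by
    rw [le_div_iff₀ (by linarith [hρlt i₀])]
    have h2 : (1 - 2 * w i₀) ^ 2 ≤ ρ i₀ ^ 2 := pow_le_pow_left₀ h0 h1 2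
    nlinarith [mul_le_mul h2 (show 1 - ρ i₀ ≤ 2 * w i₀ by linarith)
      (by linarith [hρlt i₀]) (sq_nonneg _)]
  rw [sum_congr rfl fun i _ => hsplit i, sum_add_distrib, hsum]
  rcases hw₀ with h | h <;> rw [h] at hgain hsingle <;> nlinarith

/-- Proposition 3 (generalized Horstein–Burnashev–Zigangirov scheme): for a symmetric
binary-input channel (`P₀(y) = P₁(f(y))` for an involutive permutation `f` of `𝒴`), the
deterministic threshold encoding at a minimizer `k*` of `|Σ_{i=1}^k ρᵢ − 1/2|` obtains EJS
divergence at least `D(P₀ ‖ ½P₀ + ½P₁)` (the capacity of such a channel). -/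
theorem ghbz_ejs_ge_capacity
    {Y : Type*} [Fintype Y]
    (P0 P1 : Y → ℝ)
    (hP00 : ∀ y, 0 ≤ P0 y) (hP01 : ∑ y, P0 y = 1)
    (hP10 : ∀ y, 0 ≤ P1 y) (hP11 : ∑ y, P1 y = 1)
    (f : Y → Y) (hf : Function.Involutive f)
    (hsym : ∀ y, P0 y = P1 (f y))
    (M : ℕ) (hM : 2 ≤ M)
    (ρ : Fin M → ℝ) (hρ0 : ∀ i, 0 ≤ ρ i) (hρ1 : ∑ i, ρ i = 1)
    (hρlt : ∀ i, ρ i < 1)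
    (kstar : ℕ) (hk1 : 1 ≤ kstar) (hkM : kstar ≤ M)
    (hkmin : ∀ k : ℕ, 1 ≤ k → k ≤ M →
      |(∑ i ∈ univ.filter (fun i : Fin M => (i : ℕ) < kstar), ρ i) - 1 / 2|
        ≤ |(∑ i ∈ univ.filter (fun i : Fin M => (i : ℕ) < k), ρ i) - 1 / 2|) :
    KL P0 (fun y => (1 / 2) * P0 y + (1 / 2) * P1 y)
      ≤ EJS ρ (fun i => if (i : ℕ) < kstar then P0 else P1) := by
  classical
  set s := ∑ i ∈ univ.filter (fun i : Fin M => (i : ℕ) < kstar), ρ i with hs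
  have hcompl : ∑ i ∈ univ.filter (fun i : Fin M => ¬ (i : ℕ) < kstar), ρ i = 1 - s := by
    rw [← hρ1, ← sum_filter_add_sum_filter_not univ (fun i : Fin M => (i : ℕ) < kstar) ρ]
    ring
  have hs0 : 0 ≤ s := sum_nonneg fun i _ => hρ0 i
  have hs1 : 0 ≤ 1 - s := hcompl ▸ sum_nonneg fun i _ => hρ0 i
  set w : Fin M → ℝ := fun i => if (i : ℕ) < kstar then 1 - s else s with hw
  have hw0 : ∀ i, 0 ≤ w i := fun i => by simp only [hw]; split_ifs <;> assumption
  have hwsum : ∑ i, ρ i * w i = 2 * s * (1 - s) := by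
    simp only [hw, mul_ite]
    rw [sum_ite, ← sum_mul, ← sum_mul, hcompl, ← hs]
    ring
  have hw1 : ∀ i, w i ≤ 1 - ρ i := by
    intro i
    simp only [hw]
    split_ifs with h
    · have := single_le_sum (f := ρ) (fun j _ => hρ0 j)
        (mem_filter (p := fun i : Fin M => (i : ℕ) < kstar).2 ⟨mem_univ i, h⟩)
      linarith
    · have := single_le_sum (f := ρ) (fun j _ => hρ0 j)
        (mem_filter (p := fun i : Fin M => ¬ (i : ℕ) < kstar).2 ⟨mem_univ i, h⟩)
      linarith
  obtain ⟨i₀, h0, h1⟩ := exists_imbalance_le_weight hρ0 hρ1 hk1 hkM hs hkmin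
  have hhalf : 1 / 2 ≤ ∑ i, ρ i * (w i / (1 - ρ i)) := by
    refine half_le_sum_mul_div_one_sub hρlt hw0 hwsum (i₀ := i₀) ?_ h0 h1
    simp only [hw]
    split_ifs <;> simp
  have hsym' : ∀ y, P1 y = P0 (f y) := fun y => by rw [hsym, hf y]
  have hC : ∑ y, P1 y * Real.logb 2 (P1 y / (1 / 2 * P1 y + 1 / 2 * P0 y))
      = ∑ y, P0 y * Real.logb 2 (P0 y / (1 / 2 * P0 y + 1 / 2 * P1 y)) := by
    rw [← Equiv.sum_comp hf.toPerm]
    simp [← hsym, ← hsym']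
  have hc : midpointSlope P1 P0 = midpointSlope P0 P1 := by
    rw [midpointSlope, midpointSlope, ← Equiv.sum_comp hf.toPerm]
    simp [← hsym, ← hsym']
  set C := ∑ y, P0 y * Real.logb 2 (P0 y / (1 / 2 * P0 y + 1 / 2 * P1 y)) with hCdef
  set c := midpointSlope P0 P1 with hcdef
  have hc0 : 0 ≤ c := midpointSlope_nonneg hP00 hP10 (hP01.trans hP11.symm)
  have hmix : ∀ y, ∑ j, ρ j * (if (j : ℕ) < kstar then P0 else P1) y
      = s * P0 y + (1 - s) * P1 y := by
    intro y
    simp only [ite_apply, mul_ite]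
    rw [sum_ite, ← sum_mul, ← sum_mul, hcompl, ← hs]
  have hKL : ∀ i : Fin M, ((C + c * (w i / (1 - ρ i) - 1 / 2) : ℝ) : EReal)
      ≤ KL (if (i : ℕ) < kstar then P0 else P1) (fun y => ∑ j ∈ univ.erase i,
        (ρ j / (1 - ρ i)) * (if (j : ℕ) < kstar then P0 else P1) y) := by
    intro i
    have hpos : 0 < 1 - ρ i := by linarith [hρlt i]
    have ha0 := div_nonneg (hw0 i) hpos.le
    have ha1 := (div_le_one hpos).2 (hw1 i)
    have hQ : ∀ y, ∑ j ∈ univ.erase i,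
        (ρ j / (1 - ρ i)) * (if (j : ℕ) < kstar then P0 else P1) y
        = (s * P0 y + (1 - s) * P1 y - ρ i * (if (i : ℕ) < kstar then P0 else P1) y)
          / (1 - ρ i) := by
      intro y
      rw [← hmix, ← add_sum_erase univ _ (mem_univ i), add_sub_cancel_left, sum_div]
      exact sum_congr rfl fun j _ => by ring
    simp only [hQ]
    by_cases h : (i : ℕ) < kstar
    · simp only [hw, h, if_true] at ha0 ha1 ⊢
      convert coe_midpoint_tangent_le_KL hP00 hP10 ha0 ha1 using 3
      field_simp
      ring
    · simp only [hw, h, if_false] at ha0 ha1 ⊢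
      rw [← hC, ← hc]
      convert coe_midpoint_tangent_le_KL hP10 hP00 ha0 ha1 using 3
      field_simp
      ring
  have hne : ∀ y, P0 y ≠ 0 → 1 / 2 * P0 y + 1 / 2 * P1 y ≠ 0 := fun y h h' =>
    h (by linarith [hP00 y, hP10 y])
  calc KL P0 (fun y => 1 / 2 * P0 y + 1 / 2 * P1 y) = (C : EReal) := KL_eq_coe hne
    _ ≤ ((∑ i, ρ i * (C + c * (w i / (1 - ρ i) - 1 / 2)) : ℝ) : EReal) := by
      rw [EReal.coe_le_coe_iff]
      have : ∑ i, ρ i * (C + c * (w i / (1 - ρ i) - 1 / 2))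
          = (∑ i, ρ i) * (C - c / 2) + c * ∑ i, ρ i * (w i / (1 - ρ i)) := by
        rw [sum_mul, mul_sum, ← sum_add_distrib]
        exact sum_congr rfl fun i _ => by ring
      rw [this, hρ1]
      nlinarith
    _ ≤ _ := by
      rw [EReal.coe_sum_finset, EJS]
      refine sum_le_sum fun i _ => ?_
      rw [EReal.coe_mul]
      exact mul_le_mul_of_nonneg_left (hKL i) (EReal.coe_nonneg.2 (hρ0 i))
end
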